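/- Let 2 < p < ∞ and set ζ = max(4, 2^{(p−3)/2}·√(p(p−1))). Let m ≥ 1 and let j_0 < j_1 < … < j_m be natural numbers. Then for all real scalars (a_k)_{k=0}^m and every 0 ≤ k_0 < m, every minimizer t_0 of the function t ↦ ‖Σ_{k=0}^{k_0−1} a_k h_{j_k}^{(p)} + t·h_{j_{k_0}}^{(p)} + Σ_{k=k_0+1}^m a_k h_{j_k}^{(p)}‖_{L_p[0,1]} satisfies |t_0| ≤ ζ·Σ_{k=k_0+1}^m |a_k|. That is, every finite subsequence of the Haar basis of L_p[0,1] has Property P with the constant ζ, which is independent of m. -/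

import Mathlib

open MeasureTheory

/-- The Haar functions on `[0,1]` (extended by `0` to all of `ℝ`): `haarFn 0` is the
indicator of `[0,1)` (i.e. `h₀ ≡ 1` on `[0,1]` up to the single point `1`), and for
`i = 2^n + k` with `0 ≤ k < 2^n` (so that `n = Nat.log 2 i`), `haarFn i` is `1` on
`[k/2^n, (2k+1)/2^(n+1))`, `-1` on `[(2k+1)/2^(n+1), (k+1)/2^n)` and `0` elsewhere. -/
noncomputable def haarFn (i : ℕ) : ℝ → ℝ :=
  if i = 0 then Set.indicator (Set.Ico (0 : ℝ) 1) 1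
  else
    let n := Nat.log 2 i
    let k := i - 2 ^ n
    fun t =>
      Set.indicator (Set.Ico ((k : ℝ) / 2 ^ n) ((2 * (k : ℝ) + 1) / 2 ^ (n + 1))) 1 t -
        Set.indicator (Set.Ico ((2 * (k : ℝ) + 1) / 2 ^ (n + 1)) (((k : ℝ) + 1) / 2 ^ n)) 1 t

/-- The `L_p[0,1]` norm of a function `f : ℝ → ℝ`. -/
noncomputable def pnorm (p : ℝ) (f : ℝ → ℝ) : ℝ :=
  (eLpNorm f (ENNReal.ofReal p) (volume.restrict (Set.Ico (0 : ℝ) 1))).toReal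

/-- The `L_p`-normalized Haar function `h_i^{(p)} = h_i / ‖h_i‖_p`. -/
noncomputable def haarFnP (p : ℝ) (i : ℕ) : ℝ → ℝ :=
  fun t => haarFn i t / pnorm p (haarFn i)

/-- The norming functional of a nonzero `y ∈ L_p[0,1]` applied to `g`:
`F_y(g) = ‖y‖_p^{1−p} ∫₀¹ sign(y(t)) |y(t)|^{p−1} g(t) dt`. -/
noncomputable def normingF (p : ℝ) (y g : ℝ → ℝ) : ℝ :=
  pnorm p y ^ (1 - p) *
    ∫ t in Set.Ico (0 : ℝ) 1, Real.sign (y t) * |y t| ^ (p - 1) * g t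

/-- The tangent line bound for the convex function `|·| ^ p`. -/
lemma exists_tangent_le_abs_add_rpow {p : ℝ} (hp : 2 < p) (k : ℝ) :
    ∃ α : ℝ, ∀ y : ℝ, |k| ^ p + α * y ≤ |k + y| ^ p := by
  rcases eq_or_ne k 0 with rfl | hk
  · refine ⟨0, fun y => ?_⟩
    rw [abs_zero, Real.zero_rpow (by linarith)]
    simpa using Real.rpow_nonneg (abs_nonneg y) p
  · refine ⟨|k| ^ p * p / k, fun y => ?_⟩
    have hk' : 0 < |k| ^ p := Real.rpow_pos_of_pos (abs_pos.2 hk) p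
    have hB : 1 + p * (|1 + y / k| - 1) ≤ |1 + y / k| ^ p := by
      simpa using one_add_mul_self_le_rpow_one_add
        (s := |1 + y / k| - 1) (by linarith [abs_nonneg (1 + y / k)]) (by linarith : 1 ≤ p)
    have hfac : |k + y| ^ p = |k| ^ p * |1 + y / k| ^ p := by
      rw [← Real.mul_rpow (abs_nonneg _) (abs_nonneg _), ← abs_mul]
      congr 2; field_simp
    have h1 : 1 + p * (y / k) ≤ |1 + y / k| ^ p := by
      nlinarith [le_abs_self (1 + y / k)]
    calc |k| ^ p + |k| ^ p * p / k * y = |k| ^ p * (1 + p * (y / k)) := by ring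
      _ ≤ |k| ^ p * |1 + y / k| ^ p := by gcongr
      _ = |k + y| ^ p := hfac.symm

lemma abs_rpow_eq_sq_rpow (x p : ℝ) : |x| ^ p = (x ^ 2) ^ (p / 2) := by
  rw [← sq_abs, ← Real.rpow_natCast, ← Real.rpow_mul (abs_nonneg _)]
  congr 1; push_cast; ring

/-- A lower bound for symmetric averages of `|·| ^ p`. -/
lemma rpow_sq_add_sq_le {p : ℝ} (hp : 2 < p) (c s : ℝ) :
    (c ^ 2 + s ^ 2) ^ (p / 2) ≤ (|c + s| ^ p + |c - s| ^ p) / 2 := by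
  have h := (convexOn_rpow (by linarith : 1 ≤ p / 2)).2
    (Set.mem_Ici.2 (sq_nonneg (c + s))) (Set.mem_Ici.2 (sq_nonneg (c - s)))
    (by norm_num : (0 : ℝ) ≤ 1 / 2) (by norm_num : (0 : ℝ) ≤ 1 / 2) (by norm_num)
  simp only [smul_eq_mul] at h
  rw [abs_rpow_eq_sq_rpow, abs_rpow_eq_sq_rpow]
  calc (c ^ 2 + s ^ 2) ^ (p / 2)
      = (1 / 2 * (c + s) ^ 2 + 1 / 2 * (c - s) ^ 2) ^ (p / 2) := by congr 1; ring
    _ ≤ _ := h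
    _ = _ := by ring

lemma abs_rpow_le_symm_mean {p : ℝ} (hp : 2 < p) (c s : ℝ) :
    |s| ^ p ≤ (|c + s| ^ p + |c - s| ^ p) / 2 := by
  refine le_trans ?_ (rpow_sq_add_sq_le hp c s)
  rw [abs_rpow_eq_sq_rpow s]
  exact Real.rpow_le_rpow (sq_nonneg _) (by nlinarith [sq_nonneg c]) (by linarith)

lemma abs_rpow_mul_one_add_sq_le_symm_mean {p : ℝ} (hp : 2 < p) {c : ℝ} (hc : c ≠ 0) (s : ℝ) :
    |c| ^ p * (1 + s ^ 2 / c ^ 2) ≤ (|c + s| ^ p + |c - s| ^ p) / 2 := by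
  refine le_trans ?_ (rpow_sq_add_sq_le hp c s)
  have hc2 : 0 < c ^ 2 := by positivity
  have hfac : c ^ 2 + s ^ 2 = c ^ 2 * (1 + s ^ 2 / c ^ 2) := by field_simp
  rw [abs_rpow_eq_sq_rpow c, hfac, Real.mul_rpow hc2.le (by positivity)]
  gcongr
  exact Real.self_le_rpow_of_one_le (by linarith [div_nonneg (sq_nonneg s) hc2.le]) (by linarith)

lemma one_add_rpow_le {q x : ℝ} (hq : 0 ≤ q) (hx : 0 ≤ x) :
    (1 + x) ^ q ≤ max 1 (2 ^ (q - 1)) * (1 + x ^ q) := by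
  have hxq : 0 ≤ x ^ q := Real.rpow_nonneg hx q
  rcases le_total q 1 with h | h
  · calc (1 + x) ^ q ≤ 1 ^ q + x ^ q := Real.rpow_add_le_add_rpow zero_le_one hx hq h
      _ = 1 * (1 + x ^ q) := by simp
      _ ≤ _ := by gcongr; exact le_max_left _ _
  · have hc := (convexOn_rpow h).2 (Set.mem_Ici.2 (by norm_num : (0 : ℝ) ≤ 2))
      (Set.mem_Ici.2 (by positivity : 0 ≤ 2 * x))
      (by norm_num : (0 : ℝ) ≤ 1 / 2) (by norm_num : (0 : ℝ) ≤ 1 / 2) (by norm_num)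
    simp only [smul_eq_mul] at hc
    calc (1 + x) ^ q = (1 / 2 * 2 + 1 / 2 * (2 * x)) ^ q := by congr 1; ring
      _ ≤ 1 / 2 * 2 ^ q + 1 / 2 * (2 * x) ^ q := hc
      _ = 2 ^ (q - 1) * (1 + x ^ q) := by
          rw [Real.mul_rpow (by norm_num) hx, Real.rpow_sub_one (by norm_num)]; ring
      _ ≤ _ := by gcongr; exact le_max_right _ _

/-- First-order bound: `(1 + x) ^ r - 1 ≤ r x (1 + x) ^ (r - 1)`. -/
lemma one_add_rpow_sub_one_le {r x : ℝ} (hr : 1 ≤ r) (hx : 0 ≤ x) :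
    (1 + x) ^ r - 1 ≤ r * x * (1 + x) ^ (r - 1) := by
  have h1 : 0 < 1 + x := by linarith
  have hB := one_add_mul_self_le_rpow_one_add
    (s := -(x / (1 + x))) (by rw [neg_le_neg_iff, div_le_one h1]; linarith) hr
  have e : 1 + -(x / (1 + x)) = (1 + x)⁻¹ := by field_simp; ring
  rw [e, Real.inv_rpow h1.le] at hB
  have hpos : 0 < (1 + x) ^ r := Real.rpow_pos_of_pos h1 r
  have h2 := mul_le_mul_of_nonneg_left hB hpos.le
  rw [mul_inv_cancel₀ hpos.ne'] at h2
  rw [Real.rpow_sub_one h1.ne']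
  calc (1 + x) ^ r - 1
      ≤ (1 + x) ^ r - (1 + x) ^ r * (1 + r * -(x / (1 + x))) := by linarith
    _ = _ := by ring

/-- The quadratic growth constant of `|1 + ·| ^ p` at the origin. -/
noncomputable def growthConst (p : ℝ) : ℝ := p * (p - 1) * max 1 (2 ^ (p - 3))

lemma mul_sub_one_le_growthConst {p : ℝ} (hp : 2 < p) : p * (p - 1) ≤ growthConst p :=
  le_mul_of_one_le_right (by nlinarith) (le_max_left _ _)

lemma one_add_rpow_le_quadratic {p x : ℝ} (hp : 2 < p) (hx : 0 ≤ x) :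
    (1 + x) ^ p ≤ 1 + p * x + growthConst p / 2 * (x ^ 2 + x ^ p) := by
  set K := growthConst p with hK
  have hK0 : 0 ≤ K := le_trans (by nlinarith) (mul_sub_one_le_growthConst hp)
  let ψ : ℝ → ℝ := fun x => 1 + p * x + K / 2 * (x ^ 2 + x ^ p) - (1 + x) ^ p
  have hder : ∀ y : ℝ, 0 ≤ y → HasDerivAt ψ
      (p + K / 2 * (2 * y + p * y ^ (p - 1)) - p * (1 + y) ^ (p - 1)) y := fun y hy => by
    have h1 := (hasDerivAt_id y).const_mul p
    have h2 := (hasDerivAt_pow 2 y).add (Real.hasDerivAt_rpow_const (x := y) (p := p)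
      (Or.inr (by linarith)))
    have h3 := ((hasDerivAt_id y).const_add 1).rpow_const (p := p) (Or.inr (by linarith))
    refine (((h1.const_add 1).add (h2.const_mul (K / 2))).sub h3).congr_deriv ?_
    simp
  have hmono : MonotoneOn ψ (Set.Ici 0) := by
    refine monotoneOn_of_deriv_nonneg (convex_Ici 0)
      (fun y hy => (hder y hy).continuousAt.continuousWithinAt)
      (fun y hy => (hder y (interior_subset hy)).differentiableAt.differentiableWithinAt)
      fun y hy => ?_
    have hy0 : 0 < y := by simpa using hy
    rw [(hder y hy0.le).deriv]
    have h1 := one_add_rpow_sub_one_le (r := p - 1) (by linarith) hy0.le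
    have h2 := one_add_rpow_le (q := p - 2) (by linarith) hy0.le
    rw [show p - 1 - 1 = p - 2 by ring] at h1
    rw [show p - 2 - 1 = p - 3 by ring] at h2
    have h3 : y ^ (p - 1) = y * y ^ (p - 2) := by
      rw [show p - 1 = (p - 2) + 1 by ring, Real.rpow_add_one hy0.ne', mul_comm]
    have h4 : p * ((1 + y) ^ (p - 1) - 1) ≤ K * (y + y ^ (p - 1)) := by
      calc p * ((1 + y) ^ (p - 1) - 1)
          ≤ p * ((p - 1) * y * (max 1 (2 ^ (p - 3)) * (1 + y ^ (p - 2)))) := by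
            refine mul_le_mul_of_nonneg_left (h1.trans ?_) (by linarith)
            exact mul_le_mul_of_nonneg_left h2 (mul_nonneg (by linarith) hy0.le)
        _ = K * (y + y ^ (p - 1)) := by rw [h3, hK, growthConst]; ring
    have h5 : 0 ≤ K * y ^ (p - 1) * (p / 2 - 1) :=
      mul_nonneg (mul_nonneg hK0 (Real.rpow_nonneg hy0.le _)) (by linarith)
    nlinarith
  have h := hmono (Set.mem_Ici.2 le_rfl) (Set.mem_Ici.2 hx) hx
  have h0 : ψ 0 = 0 := by simp [ψ, Real.zero_rpow (by linarith : p ≠ 0)]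
  rw [h0] at h
  simp only [ψ] at h
  linarith

lemma one_sub_rpow_le_quadratic {p y : ℝ} (hp : 2 < p) (hy : 0 ≤ y) (hy1 : y ≤ 1) :
    (1 - y) ^ p ≤ 1 - p * y + p * (p - 1) / 2 * y ^ 2 := by
  let ψ : ℝ → ℝ := fun x => 1 - p * x + p * (p - 1) / 2 * x ^ 2 - (1 - x) ^ p
  have hder : ∀ y : ℝ, HasDerivAt ψ
      (-p + p * (p - 1) * y + p * (1 - y) ^ (p - 1)) y := fun y => by
    have h1 := (hasDerivAt_id y).const_mul p
    have h2 := (hasDerivAt_pow 2 y).const_mul (p * (p - 1) / 2)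
    have h3 := ((hasDerivAt_id y).const_sub 1).rpow_const (p := p) (Or.inr (by linarith))
    refine (((h1.const_sub 1).add h2).sub h3).congr_deriv ?_
    simp; ring
  have hmono : MonotoneOn ψ (Set.Icc 0 1) := by
    refine monotoneOn_of_deriv_nonneg (convex_Icc 0 1)
      (fun y _ => (hder y).continuousAt.continuousWithinAt)
      (fun y _ => (hder y).differentiableAt.differentiableWithinAt)
      fun y hy => ?_
    have hy' : 0 < y ∧ y < 1 := by simpa using hy
    rw [(hder y).deriv]
    have hB := one_add_mul_self_le_rpow_one_add
      (s := -y) (by linarith) (by linarith : 1 ≤ p - 1)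
    rw [← sub_eq_add_neg] at hB
    nlinarith
  have h := hmono (by simp) (Set.mem_Icc.2 ⟨hy, hy1⟩) hy
  have h0 : ψ 0 = 0 := by simp [ψ]
  rw [h0] at h
  simp only [ψ] at h
  linarith

/-- Second-order growth of `|1 + ·| ^ p` at the origin. -/
lemma abs_one_add_rpow_le_quadratic {p : ℝ} (hp : 2 < p) (x : ℝ) :
    |1 + x| ^ p ≤ 1 + p * x + growthConst p / 2 * (x ^ 2 + |x| ^ p) := by
  have hK := mul_sub_one_le_growthConst hp
  rcases le_total 0 x with hx | hx
  · rw [abs_of_nonneg hx, abs_of_nonneg (by linarith)]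
    exact one_add_rpow_le_quadratic hp hx
  obtain ⟨y, rfl⟩ : ∃ y, x = -y := ⟨-x, by ring⟩
  have hy : 0 ≤ y := by linarith
  rw [abs_neg, abs_of_nonneg hy]
  have hyp : 0 ≤ y ^ p := Real.rpow_nonneg hy p
  have hsum : p * (p - 1) / 2 * (y ^ 2 + y ^ p) ≤ growthConst p / 2 * (y ^ 2 + y ^ p) := by
    gcongr
  rcases le_total y 1 with hy1 | hy1
  · rw [abs_of_nonneg (by linarith), ← sub_eq_add_neg]
    have := one_sub_rpow_le_quadratic hp hy hy1
    have h2 : 0 ≤ p * (p - 1) / 2 * y ^ p := mul_nonneg (by nlinarith) hyp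
    nlinarith
  · rw [abs_of_nonpos (by linarith)]
    have h1 : (-(1 + -y)) ^ p ≤ y ^ p := Real.rpow_le_rpow (by linarith) (by linarith) (by linarith)
    have h2 : y ^ p ≤ p * (p - 1) / 2 * y ^ p := le_mul_of_one_le_left hyp (by nlinarith)
    have h3 : 0 ≤ 1 - p * y + p * (p - 1) / 2 * y ^ 2 := by
      nlinarith [sq_nonneg (p * y / 2 - 1), mul_nonneg (mul_nonneg (by linarith : 0 ≤ p)
        (by linarith : 0 ≤ p - 2)) (sq_nonneg y)]
    nlinarith

lemma exists_abs_add_rpow_le_of_le {p : ℝ} (hp : 2 < p) {c D : ℝ} (hD : 0 < D)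
    (hc : |c| ≤ 3 * D) : ∃ α β γ : ℝ, 0 ≤ γ ∧ β + γ * D ^ p = (4 * D) ^ p ∧
      ∀ y : ℝ, |c + y| ^ p ≤ β + α * y + γ * |y| ^ p := by
  refine ⟨0, 3 / 4 * (4 * D) ^ p, 1 / 4 * 4 ^ p, by positivity, ?_, fun y => ?_⟩
  · rw [Real.mul_rpow (by norm_num) hD.le]; ring
  · have h := (convexOn_rpow (by linarith : 1 ≤ p)).2
      (Set.mem_Ici.2 (by positivity : 0 ≤ 4 * D)) (Set.mem_Ici.2 (by positivity : 0 ≤ 4 * |y|))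
      (by norm_num : (0 : ℝ) ≤ 3 / 4) (by norm_num : (0 : ℝ) ≤ 1 / 4) (by norm_num)
    simp only [smul_eq_mul] at h
    calc |c + y| ^ p ≤ (3 / 4 * (4 * D) + 1 / 4 * (4 * |y|)) ^ p := by
          refine Real.rpow_le_rpow (abs_nonneg _) ?_ (by linarith)
          linarith [abs_add_le c y]
      _ ≤ _ := h
      _ = _ := by rw [Real.mul_rpow (by norm_num : (0 : ℝ) ≤ 4) (abs_nonneg y)]; ring

lemma exists_abs_add_rpow_le_of_ge {p : ℝ} (hp : 2 < p) {c D : ℝ} (hD : 0 < D)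
    (hc : D ≤ |c|) : ∃ α β γ : ℝ, 0 ≤ γ ∧
      β + γ * D ^ p = |c| ^ p * (1 + growthConst p * D ^ 2 / c ^ 2) ∧
      ∀ y : ℝ, |c + y| ^ p ≤ β + α * y + γ * |y| ^ p := by
  have hc0 : c ≠ 0 := abs_pos.1 (hD.trans_le hc)
  have hcp : 0 < |c| ^ p := Real.rpow_pos_of_pos (abs_pos.2 hc0) p
  have hDp : 0 < D ^ p := Real.rpow_pos_of_pos hD p
  set K := growthConst p with hK
  have hK0 : 0 ≤ K := le_trans (by nlinarith) (mul_sub_one_le_growthConst hp)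
  have hc2 : 0 < c ^ 2 := by positivity
  set G := |c| ^ p * (K / 2) * (D ^ 2 / c ^ 2) with hG
  have hG0 : 0 ≤ G := by positivity
  refine ⟨|c| ^ p * p / c, |c| ^ p + G * (1 - 2 / p), G * (1 + 2 / p) / D ^ p, ?_, ?_, fun y => ?_⟩
  · have : 0 < p := by linarith
    positivity
  · rw [div_mul_cancel₀ _ hDp.ne', hG]; ring
  have hfac : |c + y| ^ p = |c| ^ p * |1 + y / c| ^ p := by
    rw [← Real.mul_rpow (abs_nonneg _) (abs_nonneg _), ← abs_mul]
    congr 2; field_simp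
  have hp0 : 0 < p := by linarith
  set z := |y| ^ p / D ^ p with hz
  have hz0 : 0 ≤ z := div_nonneg (Real.rpow_nonneg (abs_nonneg _) _) hDp.le
  have hY : y ^ 2 / D ^ 2 ≤ 1 - 2 / p + 2 / p * z := by
    have hB := one_add_mul_self_le_rpow_one_add
      (s := y ^ 2 / D ^ 2 - 1) (by linarith [show 0 ≤ y ^ 2 / D ^ 2 by positivity])
      (by linarith : 1 ≤ p / 2)
    have e : (1 + (y ^ 2 / D ^ 2 - 1)) ^ (p / 2) = z := by
      rw [hz, ← Real.div_rpow (abs_nonneg _) hD.le, add_sub_cancel, ← sq_abs y, ← div_pow,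
        ← Real.rpow_natCast, ← Real.rpow_mul (by positivity)]
      congr 1; push_cast; ring
    rw [e] at hB
    have := mul_le_mul_of_nonneg_left hB (by positivity : 0 ≤ 2 / p)
    have e2 : 2 / p * (1 + p / 2 * (y ^ 2 / D ^ 2 - 1)) = 2 / p + (y ^ 2 / D ^ 2 - 1) := by
      field_simp
    linarith
  have h1 : (y / c) ^ 2 ≤ D ^ 2 / c ^ 2 * (1 - 2 / p + 2 / p * z) := by
    calc (y / c) ^ 2 = D ^ 2 / c ^ 2 * (y ^ 2 / D ^ 2) := by field_simp
      _ ≤ _ := by gcongr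
  have h2 : |y / c| ^ p ≤ D ^ 2 / c ^ 2 * z := by
    have e : |y / c| ^ p = (D / |c|) ^ p * z := by
      rw [hz, abs_div, Real.div_rpow (abs_nonneg _) (abs_nonneg _),
        Real.div_rpow hD.le (abs_nonneg _)]
      field_simp
    have h3 : (D / |c|) ^ p ≤ D ^ 2 / c ^ 2 := by
      calc (D / |c|) ^ p ≤ (D / |c|) ^ (2 : ℝ) :=
            Real.rpow_le_rpow_of_exponent_ge (by positivity)
              ((div_le_one (abs_pos.2 hc0)).2 hc) hp.le
        _ = D ^ 2 / c ^ 2 := by rw [Real.rpow_two, div_pow, sq_abs]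
    rw [e]; gcongr
  rw [hfac]
  calc |c| ^ p * |1 + y / c| ^ p
      ≤ |c| ^ p * (1 + p * (y / c) + K / 2 * ((y / c) ^ 2 + |y / c| ^ p)) := by
        gcongr; exact abs_one_add_rpow_le_quadratic hp _
    _ ≤ |c| ^ p * (1 + p * (y / c) + K / 2 *
          (D ^ 2 / c ^ 2 * (1 - 2 / p + 2 / p * z) + D ^ 2 / c ^ 2 * z)) := by gcongr
    _ = |c| ^ p + G * (1 - 2 / p) + |c| ^ p * p / c * y + G * (1 + 2 / p) * z := by
        rw [hG]; ring
    _ = _ := by rw [hz]; ring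

lemma growthConst_le {p : ℝ} (hp : 2 < p) :
    growthConst p ≤ (max 4 (2 ^ ((p - 3) / 2) * Real.sqrt (p * (p - 1)))) ^ 2 := by
  have hpp : 0 ≤ p * (p - 1) := by nlinarith
  have e : (2 ^ ((p - 3) / 2) * Real.sqrt (p * (p - 1))) ^ 2 = p * (p - 1) * 2 ^ (p - 3) := by
    rw [mul_pow, Real.sq_sqrt hpp, ← Real.rpow_natCast, ← Real.rpow_mul (by norm_num)]
    rw [show (p - 3) / 2 * ((2 : ℕ) : ℝ) = p - 3 by push_cast; ring]; ring
  rcases le_total 3 p with h | h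
  · have h1 : (1 : ℝ) ≤ 2 ^ (p - 3) := Real.one_le_rpow (by norm_num) (by linarith)
    rw [growthConst, max_eq_right h1, ← e]
    gcongr
    exact le_max_right _ _
  · have h1 : (2 : ℝ) ^ (p - 3) ≤ 1 := Real.rpow_le_one_of_one_le_of_nonpos (by norm_num) (by linarith)
    rw [growthConst, max_eq_left h1]
    calc p * (p - 1) * 1 ≤ 4 ^ 2 := by nlinarith
      _ ≤ _ := by gcongr; exact le_max_left _ _

lemma Measurable.integrable_continuous_comp {μ : Measure ℝ} [IsFiniteMeasure μ] {v : ℝ → ℝ}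
    (hv : Measurable v) {C : ℝ} (hC : ∀ x, |v x| ≤ C) {φ : ℝ → ℝ} (hφ : Continuous φ) :
    Integrable (fun x => φ (v x)) μ := by
  obtain ⟨b, hb⟩ := (isCompact_Icc (a := -C) (b := C)).exists_bound_of_continuousOn hφ.continuousOn
  exact Integrable.of_bound (hφ.measurable.comp hv).aestronglyMeasurable b
    (Filter.Eventually.of_forall fun x => hb _ (abs_le.1 (hC x)))

lemma measureReal_mul_abs_rpow_le_setIntegral {p : ℝ} (hp : 2 < p) {μ : Measure ℝ}
    [IsFiniteMeasure μ] {A : Set ℝ} {v : ℝ → ℝ} (hv : Measurable v) {C : ℝ} (hC : ∀ x, |v x| ≤ C)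
    (h0 : ∫ x in A, v x ∂μ = 0) (k : ℝ) :
    μ.real A * |k| ^ p ≤ ∫ x in A, |k + v x| ^ p ∂μ := by
  obtain ⟨α, hα⟩ := exists_tangent_le_abs_add_rpow hp k
  have hp0 : 0 ≤ p := by linarith
  have hvi : Integrable v (μ.restrict A) := hv.integrable_continuous_comp hC continuous_id
  have hi : Integrable (fun x => |k + v x| ^ p) (μ.restrict A) :=
    hv.integrable_continuous_comp hC (φ := fun y => |k + y| ^ p)
      ((continuous_const.add continuous_id).abs.rpow_const fun _ => Or.inr hp0)
  calc μ.real A * |k| ^ p = ∫ x in A, (|k| ^ p + α * v x) ∂μ := by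
        rw [integral_add (integrable_const _) (hvi.const_mul α), integral_const_mul, h0]; simp
    _ ≤ _ := integral_mono ((integrable_const _).add (hvi.const_mul α)) hi fun x => hα (v x)

lemma setIntegral_abs_add_rpow_le {p : ℝ} (hp : 2 < p) {μ : Measure ℝ}
    [IsFiniteMeasure μ] {A : Set ℝ} {v : ℝ → ℝ} (hv : Measurable v) {C : ℝ} (hC : ∀ x, |v x| ≤ C)
    (h0 : ∫ x in A, v x ∂μ = 0) {c α β γ : ℝ}
    (h : ∀ y : ℝ, |c + y| ^ p ≤ β + α * y + γ * |y| ^ p) :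
    ∫ x in A, |c + v x| ^ p ∂μ ≤ μ.real A * β + γ * ∫ x in A, |v x| ^ p ∂μ := by
  have hp0 : 0 ≤ p := by linarith
  have hvi : Integrable v (μ.restrict A) := hv.integrable_continuous_comp hC continuous_id
  have hi : Integrable (fun x => |c + v x| ^ p) (μ.restrict A) :=
    hv.integrable_continuous_comp hC (φ := fun y => |c + y| ^ p)
      ((continuous_const.add continuous_id).abs.rpow_const fun _ => Or.inr hp0)
  have hi0 : Integrable (fun x => |v x| ^ p) (μ.restrict A) :=
    hv.integrable_continuous_comp hC (φ := fun y => |y| ^ p)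
      (continuous_abs.rpow_const fun _ => Or.inr hp0)
  have hi1 : Integrable (fun x => β + α * v x) (μ.restrict A) :=
    (integrable_const _).add (hvi.const_mul α)
  calc ∫ x in A, |c + v x| ^ p ∂μ ≤ ∫ x in A, (β + α * v x + γ * |v x| ^ p) ∂μ :=
        integral_mono hi (hi1.add (hi0.const_mul γ)) fun x => h (v x)
    _ = _ := by
        rw [integral_add hi1 (hi0.const_mul γ), integral_add (integrable_const _) (hvi.const_mul α),
          integral_const_mul, integral_const_mul, h0]
        simp

/-- If moving from `c` to `c ± s` on the two pieces `A`, `B` does not increase the `p`-th power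
integral, then `s` is controlled by the `p`-mean `D` of the perturbation `v`. -/
lemma abs_le_of_setIntegral_le {p : ℝ} (hp : 2 < p) {μ : Measure ℝ} [IsFiniteMeasure μ]
    {A B : Set ℝ} {v : ℝ → ℝ} (hv : Measurable v) {C : ℝ} (hC : ∀ x, |v x| ≤ C)
    (hA : ∫ x in A, v x ∂μ = 0) (hB : ∫ x in B, v x ∂μ = 0) {c s D : ℝ}
    (hc : c = 0 ∨ μ.real A = μ.real B) (hM : 0 < μ.real A + μ.real B) (hD : 0 < D)
    (hvD : ∫ x in A, |v x| ^ p ∂μ + ∫ x in B, |v x| ^ p ∂μ ≤ (μ.real A + μ.real B) * D ^ p)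
    (hle : ∫ x in A, |c + s + v x| ^ p ∂μ + ∫ x in B, |c - s + v x| ^ p ∂μ ≤
      ∫ x in A, |c + v x| ^ p ∂μ + ∫ x in B, |c + v x| ^ p ∂μ) :
    |s| ≤ max 4 (2 ^ ((p - 3) / 2) * Real.sqrt (p * (p - 1))) * D := by
  have hlowA := measureReal_mul_abs_rpow_le_setIntegral hp hv hC hA (c + s)
  have hlowB := measureReal_mul_abs_rpow_le_setIntegral hp hv hC hB (c - s)
  have hup : ∀ α β γ R : ℝ, 0 ≤ γ → β + γ * D ^ p = R →
      (∀ y : ℝ, |c + y| ^ p ≤ β + α * y + γ * |y| ^ p) →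
      μ.real A * |c + s| ^ p + μ.real B * |c - s| ^ p ≤ (μ.real A + μ.real B) * R := by
    intro α β γ R hγ hR h
    have h1 := setIntegral_abs_add_rpow_le hp hv hC hA h
    have h2 := setIntegral_abs_add_rpow_le hp hv hC hB h
    have h3 := mul_le_mul_of_nonneg_left hvD hγ
    rw [← hR]
    linarith
  have hmean : c = 0 ∨ μ.real A * |c + s| ^ p + μ.real B * |c - s| ^ p =
      (μ.real A + μ.real B) * ((|c + s| ^ p + |c - s| ^ p) / 2) := by
    refine hc.imp_right fun h => ?_
    rw [h]; ring
  rcases le_total |c| (3 * D) with hcD | hcD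
  · obtain ⟨α, β, γ, hγ, hR, h⟩ := exists_abs_add_rpow_le_of_le hp hD hcD
    have h1 := hup α β γ _ hγ hR h
    have h2 : (μ.real A + μ.real B) * |s| ^ p ≤ (μ.real A + μ.real B) * (4 * D) ^ p := by
      refine le_trans ?_ h1
      rcases hmean with rfl | hm
      · simp [add_mul]
      · rw [hm]
        exact mul_le_mul_of_nonneg_left (abs_rpow_le_symm_mean hp c s) hM.le
    have h3 := (Real.rpow_le_rpow_iff (abs_nonneg s) (by positivity) (by linarith)).1
      (le_of_mul_le_mul_left h2 hM)
    refine h3.trans ?_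
    gcongr
    exact le_max_left _ _
  · have hc0 : c ≠ 0 := abs_pos.1 (by linarith)
    obtain ⟨α, β, γ, hγ, hR, h⟩ := exists_abs_add_rpow_le_of_ge hp hD (by linarith : D ≤ |c|)
    have h1 := hup α β γ _ hγ hR h
    rw [hmean.resolve_left hc0] at h1
    have h2 := (abs_rpow_mul_one_add_sq_le_symm_mean hp hc0 s).trans (le_of_mul_le_mul_left h1 hM)
    have h3 := le_of_mul_le_mul_left h2 (Real.rpow_pos_of_pos (abs_pos.2 hc0) p)
    have hc2 : 0 < c ^ 2 := by positivity
    have h4 : s ^ 2 ≤ growthConst p * D ^ 2 :=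
      (div_le_div_iff_of_pos_right hc2).1 (by linarith)
    refine abs_le_of_sq_le_sq ?_ (mul_nonneg (le_max_of_le_left (by norm_num)) hD.le)
    rw [mul_pow]
    exact h4.trans (mul_le_mul_of_nonneg_right (growthConst_le hp) (sq_nonneg D))

/-- For `i ≠ 0`, the value of `haarFn i` at `x` is determined by the dyadic digit block of `x`. -/
lemma haarFn_eq_ite {i : ℕ} (hi : i ≠ 0) (x : ℝ) :
    haarFn i x = if ⌊(2 : ℝ) ^ (Nat.log 2 i + 1) * x⌋ = 2 * ((i - 2 ^ Nat.log 2 i : ℕ) : ℤ) then 1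
      else if ⌊(2 : ℝ) ^ (Nat.log 2 i + 1) * x⌋ = 2 * ((i - 2 ^ Nat.log 2 i : ℕ) : ℤ) + 1
      then -1 else 0 := by
  set n := Nat.log 2 i with hn
  set k := i - 2 ^ n with hk
  have h2 : (0 : ℝ) < 2 ^ (n + 1) := by positivity
  have e1 : (k : ℝ) / 2 ^ n = (2 * k) / 2 ^ (n + 1) := by rw [pow_succ]; field_simp
  have e2 : ((k : ℝ) + 1) / 2 ^ n = (2 * k + 1 + 1) / 2 ^ (n + 1) := by
    rw [pow_succ]; field_simp; ring
  have hA : x ∈ Set.Ico ((k : ℝ) / 2 ^ n) ((2 * (k : ℝ) + 1) / 2 ^ (n + 1)) ↔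
      ⌊(2 : ℝ) ^ (n + 1) * x⌋ = 2 * (k : ℤ) := by
    rw [Int.floor_eq_iff, Set.mem_Ico, e1, div_le_iff₀' h2, lt_div_iff₀' h2]
    push_cast; rfl
  have hB : x ∈ Set.Ico ((2 * (k : ℝ) + 1) / 2 ^ (n + 1)) (((k : ℝ) + 1) / 2 ^ n) ↔
      ⌊(2 : ℝ) ^ (n + 1) * x⌋ = 2 * (k : ℤ) + 1 := by
    rw [Int.floor_eq_iff, Set.mem_Ico, e2, div_le_iff₀' h2, lt_div_iff₀' h2]
    push_cast; rfl
  simp only [haarFn, if_neg hi]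
  rw [← hn, ← hk]
  simp only [Set.indicator_apply, hA, hB, Pi.one_apply]
  split_ifs <;> first | omega | norm_num

lemma haarFn_zero : haarFn 0 = Set.indicator (Set.Ico (0 : ℝ) 1) 1 := by simp [haarFn]

lemma haarFn_trichotomy (i : ℕ) (x : ℝ) : haarFn i x = 1 ∨ haarFn i x = -1 ∨ haarFn i x = 0 := by
  rcases eq_or_ne i 0 with rfl | hi
  · rw [haarFn_zero, Set.indicator_apply]
    split_ifs <;> simp
  · rw [haarFn_eq_ite hi]
    split_ifs <;> simp

lemma abs_haarFn_le_one (i : ℕ) (x : ℝ) : |haarFn i x| ≤ 1 := by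
  rcases haarFn_trichotomy i x with h | h | h <;> simp [h]

lemma measurable_haarFn (i : ℕ) : Measurable (haarFn i) := by
  unfold haarFn
  split_ifs
  · exact measurable_one.indicator measurableSet_Ico
  · exact (measurable_one.indicator measurableSet_Ico).sub
      (measurable_one.indicator measurableSet_Ico)

lemma floor_two_pow_mul_div (n d : ℕ) (x : ℝ) :
    ⌊(2 : ℝ) ^ (n + d) * x⌋ / (2 ^ d : ℕ) = ⌊(2 : ℝ) ^ n * x⌋ := by
  rw [← Int.floor_div_natCast]
  congr 1
  push_cast
  rw [pow_add]; field_simp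

lemma floor_eq_of_haarFn_ne_zero {i : ℕ} (hi : i ≠ 0) {x : ℝ} (h : haarFn i x ≠ 0) :
    ⌊(2 : ℝ) ^ Nat.log 2 i * x⌋ = ((i - 2 ^ Nat.log 2 i : ℕ) : ℤ) := by
  rw [← floor_two_pow_mul_div _ 1]
  rw [haarFn_eq_ite hi] at h
  split_ifs at h with h1 h2
  · rw [h1]; omega
  · rw [h2]; omega
  · exact absurd rfl h

lemma mem_Ico_of_haarFn_ne_zero {i : ℕ} {x : ℝ} (h : haarFn i x ≠ 0) :
    x ∈ Set.Ico (0 : ℝ) 1 := by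
  rcases eq_or_ne i 0 with rfl | hi
  · rw [haarFn_zero] at h
    exact Set.mem_of_indicator_ne_zero h
  · have hf := floor_eq_of_haarFn_ne_zero hi h
    have h2 : (0 : ℝ) < 2 ^ Nat.log 2 i := by positivity
    rw [Int.floor_eq_iff] at hf
    have hlt : i - 2 ^ Nat.log 2 i + 1 ≤ 2 ^ Nat.log 2 i := by
      have := Nat.lt_pow_succ_log_self (by norm_num : 1 < 2) i
      rw [Nat.succ_eq_add_one, pow_succ] at this
      have := Nat.pow_le_of_le_log hi (le_refl (Nat.log 2 i)) (b := 2)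
      omega
    have hlt' : (((i - 2 ^ Nat.log 2 i : ℕ) : ℤ) : ℝ) + 1 ≤ 2 ^ Nat.log 2 i := by exact_mod_cast hlt
    have h0 : (0 : ℝ) ≤ (((i - 2 ^ Nat.log 2 i : ℕ) : ℤ) : ℝ) := by positivity
    constructor
    · exact nonneg_of_mul_nonneg_right (h0.trans hf.1) h2
    · nlinarith

/-- Earlier Haar functions are constant on the support of later ones. -/
lemma haarFn_eq_of_ne_zero {i l : ℕ} (hil : i < l) {x y : ℝ} (hx : haarFn l x ≠ 0)
    (hy : haarFn l y ≠ 0) : haarFn i x = haarFn i y := by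
  rcases eq_or_ne i 0 with rfl | hi
  · rw [haarFn_zero, Set.indicator_of_mem (mem_Ico_of_haarFn_ne_zero hx),
      Set.indicator_of_mem (mem_Ico_of_haarFn_ne_zero hy)]
    rfl
  have hl : l ≠ 0 := by omega
  have hfx := floor_eq_of_haarFn_ne_zero hl hx
  have hfy := floor_eq_of_haarFn_ne_zero hl hy
  rcases (Nat.log_mono_right hil.le : Nat.log 2 i ≤ Nat.log 2 l).lt_or_eq with h | h
  · obtain ⟨d, hd⟩ := Nat.exists_eq_add_of_le (Nat.succ_le_of_lt h)
    have hd' : Nat.log 2 l = (Nat.log 2 i + 1) + d := hd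
    rw [haarFn_eq_ite hi, haarFn_eq_ite hi, ← floor_two_pow_mul_div _ d x,
      ← floor_two_pow_mul_div _ d y, ← hd', hfx, hfy]
  · have hzero : ∀ z : ℝ, haarFn l z ≠ 0 → haarFn i z = 0 := fun z hz => by
      by_contra hne
      have h1 := floor_eq_of_haarFn_ne_zero hi hne
      have h2 := floor_eq_of_haarFn_ne_zero hl hz
      rw [← h, h1] at h2
      have := Nat.pow_le_of_le_log hi (le_refl (Nat.log 2 i)) (b := 2)
      omega
    rw [hzero x hx, hzero y hy]

/-- Lebesgue measure on `[0, 1)`. -/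
noncomputable abbrev unitMeasure : Measure ℝ := volume.restrict (Set.Ico (0 : ℝ) 1)

lemma measurableSet_haarFn_eq (i : ℕ) (e : ℝ) : MeasurableSet {x | haarFn i x = e} :=
  measurable_haarFn i (measurableSet_singleton e)

lemma disjoint_haarFn_eq (i : ℕ) : Disjoint {x | haarFn i x = 1} {x | haarFn i x = -1} := by
  rw [Set.disjoint_left]
  intro x (h1 : _ = _) (h2 : _ = _)
  rw [h1] at h2; norm_num at h2

lemma unitMeasure_real_haarFn_eq {i : ℕ} {e : ℝ} (he : e ≠ 0) :
    unitMeasure.real {x | haarFn i x = e} = volume.real {x | haarFn i x = e} := by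
  rw [measureReal_restrict_apply (measurableSet_haarFn_eq i e), Set.inter_eq_left.2]
  intro x (hx : haarFn i x = e)
  exact mem_Ico_of_haarFn_ne_zero (hx.trans_ne he)

lemma volume_real_floor_eq (n : ℕ) (q : ℤ) :
    volume.real {x : ℝ | ⌊(2 : ℝ) ^ n * x⌋ = q} = 1 / 2 ^ n := by
  have h2 : (0 : ℝ) < 2 ^ n := by positivity
  have : {x : ℝ | ⌊(2 : ℝ) ^ n * x⌋ = q} = Set.Ico ((q : ℝ) / 2 ^ n) (((q : ℝ) + 1) / 2 ^ n) := by
    ext x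
    rw [Set.mem_ofPred_eq, Int.floor_eq_iff, Set.mem_Ico, div_le_iff₀' h2, lt_div_iff₀' h2]
  rw [this, Real.volume_real_Ico_of_le (by gcongr; linarith)]
  ring

lemma unitMeasure_real_haarFn_eq_one {i : ℕ} (hi : i ≠ 0) :
    unitMeasure.real {x | haarFn i x = 1} = 1 / 2 ^ (Nat.log 2 i + 1) := by
  rw [unitMeasure_real_haarFn_eq one_ne_zero, ← volume_real_floor_eq _
    (2 * ((i - 2 ^ Nat.log 2 i : ℕ) : ℤ))]
  congr 1
  ext x
  simp only [Set.mem_ofPred_eq]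
  rw [haarFn_eq_ite hi]
  split_ifs with h1 h2
  · simp [h1]
  · norm_num [h1]
  · simp [h1]

lemma unitMeasure_real_haarFn_eq_neg_one {i : ℕ} (hi : i ≠ 0) :
    unitMeasure.real {x | haarFn i x = -1} = 1 / 2 ^ (Nat.log 2 i + 1) := by
  rw [unitMeasure_real_haarFn_eq (by norm_num), ← volume_real_floor_eq _
    (2 * ((i - 2 ^ Nat.log 2 i : ℕ) : ℤ) + 1)]
  congr 1
  ext x
  simp only [Set.mem_ofPred_eq]
  rw [haarFn_eq_ite hi]
  split_ifs with h1 h2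
  · norm_num [h1]
  · simp [h2]
  · simp [h2]

/-- The measure of the support of `haarFn i`. -/
noncomputable def haarMass (i : ℕ) : ℝ :=
  unitMeasure.real {x | haarFn i x = 1} + unitMeasure.real {x | haarFn i x = -1}

lemma haarMass_pos (i : ℕ) : 0 < haarMass i := by
  unfold haarMass
  rcases eq_or_ne i 0 with rfl | hi
  · have h : {x | haarFn 0 x = 1} = Set.Ico (0 : ℝ) 1 := by
      ext x; rw [haarFn_zero]; simp [Set.indicator_apply]
    have h1 : unitMeasure.real {x | haarFn 0 x = 1} = 1 := by
      rw [unitMeasure_real_haarFn_eq one_ne_zero, h]; simp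
    rw [h1]
    linarith [measureReal_nonneg (μ := unitMeasure) (s := {x | haarFn 0 x = -1})]
  · rw [unitMeasure_real_haarFn_eq_one hi, unitMeasure_real_haarFn_eq_neg_one hi]
    positivity

lemma exists_haarFn_ne_zero (i : ℕ) : ∃ x, haarFn i x ≠ 0 := by
  by_contra! h
  have := haarMass_pos i
  simp [haarMass, h] at this

lemma integrable_haarFn (i : ℕ) (μ : Measure ℝ) [IsFiniteMeasure μ] : Integrable (haarFn i) μ :=
  (measurable_haarFn i).integrable_continuous_comp (abs_haarFn_le_one i) continuous_id

lemma integral_haarFn_eq_zero {i : ℕ} (hi : i ≠ 0) : ∫ x, haarFn i x ∂unitMeasure = 0 := by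
  have h : ∀ x, haarFn i x = Set.indicator {x | haarFn i x = 1} 1 x -
      Set.indicator {x | haarFn i x = -1} 1 x := fun x => by
    rcases haarFn_trichotomy i x with h | h | h <;> norm_num [Set.indicator_apply, h]
  have hinteg : ∀ e : ℝ, Integrable (Set.indicator {x | haarFn i x = e} (1 : ℝ → ℝ)) unitMeasure :=
    fun e => (integrable_const (1 : ℝ)).indicator (measurableSet_haarFn_eq i e)
  rw [integral_congr_ae (Filter.Eventually.of_forall h), integral_sub (hinteg 1) (hinteg (-1)),
    integral_indicator_one (measurableSet_haarFn_eq i 1),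
    integral_indicator_one (measurableSet_haarFn_eq i (-1)),
    unitMeasure_real_haarFn_eq_one hi, unitMeasure_real_haarFn_eq_neg_one hi, sub_self]

/-- A later Haar function has mean zero on each level set of an earlier one. -/
lemma setIntegral_haarFn_eq_zero {i l : ℕ} (hil : i < l) (e : ℝ) :
    ∫ x in {x | haarFn i x = e}, haarFn l x ∂unitMeasure = 0 := by
  by_cases h : ∃ x, haarFn l x ≠ 0 ∧ haarFn i x = e
  · obtain ⟨x, hx, hxe⟩ := h
    rw [setIntegral_eq_integral_of_forall_compl_eq_zero, integral_haarFn_eq_zero (by omega)]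
    intro y hy
    by_contra hne
    exact hy ((haarFn_eq_of_ne_zero hil hne hx).trans hxe)
  · push Not at h
    refine setIntegral_eq_zero_of_forall_eq_zero fun x hx => ?_
    by_contra hne
    exact h x hne hx

lemma pnorm_eq_lpNorm {p : ℝ} {f : ℝ → ℝ} (hf : Measurable f) :
    pnorm p f = lpNorm f (ENNReal.ofReal p) unitMeasure :=
  toReal_eLpNorm hf.aestronglyMeasurable

lemma pnorm_rpow {p : ℝ} (hp : 2 < p) {f : ℝ → ℝ} (hf : Measurable f) :
    pnorm p f ^ p = ∫ x, |f x| ^ p ∂unitMeasure := by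
  have hp0 : 0 < p := by linarith
  rw [pnorm_eq_lpNorm hf, lpNorm_eq_integral_norm_rpow_toReal (by simpa using hp0)
    ENNReal.ofReal_ne_top hf.aestronglyMeasurable, ENNReal.toReal_ofReal hp0.le,
    Real.rpow_inv_rpow (integral_nonneg fun x => by positivity) hp0.ne']
  rfl

lemma pnorm_nonneg (p : ℝ) (f : ℝ → ℝ) : 0 ≤ pnorm p f := ENNReal.toReal_nonneg

lemma pnorm_haarFn_rpow {p : ℝ} (hp : 2 < p) (i : ℕ) : pnorm p (haarFn i) ^ p = haarMass i := by
  have h : ∀ x, |haarFn i x| ^ p = Set.indicator {x | haarFn i x = 1} 1 x +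
      Set.indicator {x | haarFn i x = -1} 1 x := fun x => by
    rcases haarFn_trichotomy i x with h | h | h <;>
      norm_num [Set.indicator_apply, h, Real.zero_rpow (by linarith : p ≠ 0)]
  have hinteg : ∀ e : ℝ, Integrable (Set.indicator {x | haarFn i x = e} (1 : ℝ → ℝ)) unitMeasure :=
    fun e => (integrable_const (1 : ℝ)).indicator (measurableSet_haarFn_eq i e)
  rw [pnorm_rpow hp (measurable_haarFn i), integral_congr_ae (Filter.Eventually.of_forall h),
    integral_add (hinteg 1) (hinteg (-1)), integral_indicator_one (measurableSet_haarFn_eq i 1),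
    integral_indicator_one (measurableSet_haarFn_eq i (-1))]
  rfl

lemma pnorm_haarFn_pos {p : ℝ} (hp : 2 < p) (i : ℕ) : 0 < pnorm p (haarFn i) := by
  refine (pnorm_nonneg p _).lt_of_ne fun h => ?_
  have := pnorm_haarFn_rpow hp i
  rw [← h, Real.zero_rpow (by linarith)] at this
  exact (haarMass_pos i).ne this

lemma measurable_haarFnP (p : ℝ) (i : ℕ) : Measurable (haarFnP p i) :=
  (measurable_haarFn i).div_const _

lemma abs_haarFnP_le (p : ℝ) (i : ℕ) (x : ℝ) : |haarFnP p i x| ≤ 1 / pnorm p (haarFn i) := by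
  rw [haarFnP, abs_div, abs_of_nonneg (pnorm_nonneg p _)]
  exact div_le_div_of_nonneg_right (abs_haarFn_le_one i x) (pnorm_nonneg p _)

lemma pnorm_const_mul_haarFnP {p : ℝ} (hp : 2 < p) (a : ℝ) (i : ℕ) :
    pnorm p (fun x => a * haarFnP p i x) = |a| := by
  have hpos := pnorm_haarFn_pos hp i
  have h : (fun x => a * haarFnP p i x) = (a / pnorm p (haarFn i)) • haarFn i := by
    ext x; simp only [haarFnP, Pi.smul_apply, smul_eq_mul]; ring
  rw [h, pnorm_eq_lpNorm ((measurable_haarFn i).const_smul _), lpNorm_const_smul,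
    ← pnorm_eq_lpNorm (measurable_haarFn i), coe_nnnorm, Real.norm_eq_abs, abs_div,
    abs_of_pos hpos, div_mul_cancel₀ _ hpos.ne']

section HaarSum

variable (p : ℝ) (j : ℕ → ℕ) (a : ℕ → ℝ) (s : Finset ℕ)

lemma measurable_haarSum : Measurable fun x => ∑ k ∈ s, a k * haarFnP p (j k) x :=
  Finset.measurable_sum s fun k _ => (measurable_haarFnP p (j k)).const_mul (a k)

lemma abs_haarSum_le (x : ℝ) : |∑ k ∈ s, a k * haarFnP p (j k) x| ≤
    ∑ k ∈ s, |a k| * (1 / pnorm p (haarFn (j k))) := by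
  refine (Finset.abs_sum_le_sum_abs _ _).trans (Finset.sum_le_sum fun k _ => ?_)
  rw [abs_mul]
  exact mul_le_mul_of_nonneg_left (abs_haarFnP_le p _ x) (abs_nonneg _)

lemma pnorm_haarSum_le {p : ℝ} (hp : 2 < p) :
    pnorm p (fun x => ∑ k ∈ s, a k * haarFnP p (j k) x) ≤ ∑ k ∈ s, |a k| := by
  have hmeas : ∀ k, Measurable fun x => a k * haarFnP p (j k) x :=
    fun k => (measurable_haarFnP p (j k)).const_mul (a k)
  have hmem : ∀ k ∈ s, MemLp (fun x => a k * haarFnP p (j k) x) (ENNReal.ofReal p) unitMeasure :=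
    fun k _ => MemLp.of_bound (hmeas k).aestronglyMeasurable
      (|a k| * (1 / pnorm p (haarFn (j k)))) (Filter.Eventually.of_forall fun x => by
        rw [Real.norm_eq_abs, abs_mul]
        exact mul_le_mul_of_nonneg_left (abs_haarFnP_le p _ x) (abs_nonneg _))
  have h := lpNorm_sum_le hmem (ENNReal.one_le_ofReal.2 (by linarith))
  rw [Finset.sum_congr rfl fun k _ => ((pnorm_eq_lpNorm (hmeas k)).symm.trans
    (pnorm_const_mul_haarFnP hp (a k) (j k)))] at h
  rw [pnorm_eq_lpNorm (measurable_haarSum p j a s)]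
  convert h using 2
  ext x; simp

lemma setIntegral_haarSum_eq_zero {i : ℕ} (hi : ∀ k ∈ s, i < j k) (e : ℝ) :
    ∫ x in {x | haarFn i x = e}, ∑ k ∈ s, a k * haarFnP p (j k) x ∂unitMeasure = 0 := by
  rw [integral_finsetSum]
  · refine Finset.sum_eq_zero fun k hk => ?_
    simp only [haarFnP]
    rw [integral_const_mul, integral_div, setIntegral_haarFn_eq_zero (hi k hk)]
    simp
  · exact fun k _ => ((integrable_haarFn (j k) _).div_const _).const_mul _

end HaarSum

lemma setIntegral_add_setIntegral_le_of_integral_le {f g : ℝ → ℝ} (i : ℕ)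
    (hf : Integrable f unitMeasure) (hg : Integrable g unitMeasure)
    (h : ∫ x, f x ∂unitMeasure ≤ ∫ x, g x ∂unitMeasure)
    (hfg : ∀ x, haarFn i x = 0 → g x ≤ f x) :
    ∫ x in {x | haarFn i x = 1}, f x ∂unitMeasure +
        ∫ x in {x | haarFn i x = -1}, f x ∂unitMeasure ≤
      ∫ x in {x | haarFn i x = 1}, g x ∂unitMeasure +
        ∫ x in {x | haarFn i x = -1}, g x ∂unitMeasure := by
  have hA := measurableSet_haarFn_eq i 1
  have hB := measurableSet_haarFn_eq i (-1)
  rw [← setIntegral_union (disjoint_haarFn_eq i) hB hf.integrableOn hf.integrableOn,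
    ← setIntegral_union (disjoint_haarFn_eq i) hB hg.integrableOn hg.integrableOn]
  have hf' := integral_add_compl (hA.union hB) hf
  have hg' := integral_add_compl (hA.union hB) hg
  have hcompl := setIntegral_mono_on hg.integrableOn hf.integrableOn (hA.union hB).compl
    fun x hx => hfg x (by
      rcases haarFn_trichotomy i x with h | h | h
      · exact absurd (Or.inl h) hx
      · exact absurd (Or.inr h) hx
      · exact h)
  linarith

/-- for `2 < p < ∞`, every finite subsequence
`(h_{j_k}^{(p)})_{k=0}^m` (`j₀ < j₁ < … < j_m`) of the Haar basis of `L_p[0,1]`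
has Property P with the constant `ζ = max(4, 2^{(p−3)/2}√(p(p−1)))`, which is
independent of `m`. -/
theorem stmt_18 (p : ℝ) (hp : 2 < p) (m : ℕ) (hm : 1 ≤ m)
    (j : ℕ → ℕ) (hj : ∀ k < m, j k < j (k + 1))
    (a : ℕ → ℝ) (k₀ : ℕ) (hk₀ : k₀ < m) (t₀ : ℝ)
    (hmin : ∀ t : ℝ,
      pnorm p (fun s => (∑ k ∈ Finset.range k₀, a k * haarFnP p (j k) s) +
          t₀ * haarFnP p (j k₀) s +
          ∑ k ∈ Finset.Icc (k₀ + 1) m, a k * haarFnP p (j k) s) ≤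
        pnorm p (fun s => (∑ k ∈ Finset.range k₀, a k * haarFnP p (j k) s) +
          t * haarFnP p (j k₀) s +
          ∑ k ∈ Finset.Icc (k₀ + 1) m, a k * haarFnP p (j k) s)) :
    |t₀| ≤ max 4 (2 ^ ((p - 3) / 2) * Real.sqrt (p * (p - 1))) *
      ∑ k ∈ Finset.Icc (k₀ + 1) m, |a k| := by
  have hp0 : 0 < p := by linarith
  have hmono : ∀ k l, k < l → l ≤ m → j k < j l := by
    intro k l hkl
    induction l, hkl using Nat.le_induction with
    | base => exact fun hl => hj k (by omega)
    | succ l hl ih => exact fun hlm => (ih (by omega)).trans (hj l (by omega))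
  set i := j k₀ with hi
  set N := pnorm p (haarFn i) with hN
  have hNpos : 0 < N := pnorm_haarFn_pos hp i
  set u : ℝ → ℝ := fun x => ∑ k ∈ Finset.range k₀, a k * haarFnP p (j k) x with hu
  set v : ℝ → ℝ := fun x => ∑ k ∈ Finset.Icc (k₀ + 1) m, a k * haarFnP p (j k) x with hv
  set S := ∑ k ∈ Finset.Icc (k₀ + 1) m, |a k| with hS
  have hS0 : 0 ≤ S := Finset.sum_nonneg fun k _ => abs_nonneg _
  have hvm : Measurable v := measurable_haarSum p j a _
  have hum : Measurable u := measurable_haarSum p j a _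
  have hvC := abs_haarSum_le p j a (Finset.Icc (k₀ + 1) m)
  have huC := abs_haarSum_le p j a (Finset.range k₀)
  have hv0 : ∀ e : ℝ, ∫ x in {x | haarFn i x = e}, v x ∂unitMeasure = 0 :=
    setIntegral_haarSum_eq_zero p j a _ fun k hk => by
      rw [Finset.mem_Icc] at hk
      exact hmono k₀ k (by omega) hk.2
  obtain ⟨x₀, hx₀⟩ := exists_haarFn_ne_zero i
  have huc : ∀ x, haarFn i x ≠ 0 → u x = u x₀ := fun x hx =>
    Finset.sum_congr rfl fun k hk => by
      rw [haarFnP, haarFnP, haarFn_eq_of_ne_zero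
        (hmono k k₀ (Finset.mem_range.1 hk) hk₀.le) hx hx₀]
  have hc : u x₀ = 0 ∨ unitMeasure.real {x | haarFn i x = 1} =
      unitMeasure.real {x | haarFn i x = -1} := by
    rcases eq_or_ne i 0 with h0 | h0
    · left
      have hk0 : k₀ = 0 := by
        by_contra hne
        have := hmono 0 k₀ (by omega) hk₀.le
        omega
      simp [hu, hk0]
    · right
      rw [unitMeasure_real_haarFn_eq_one h0, unitMeasure_real_haarFn_eq_neg_one h0]
  let f : ℝ → ℝ → ℝ := fun t x => u x + t * haarFnP p i x + v x
  have hfm : ∀ t, Measurable (f t) := fun t =>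
    (hum.add ((measurable_haarFnP p i).const_mul t)).add hvm
  have hfi : ∀ t, Integrable (fun x => |f t x| ^ p) unitMeasure := fun t =>
    (hfm t).integrable_continuous_comp
      (fun x => (abs_add_three _ _ _).trans (add_le_add (add_le_add (huC x)
        ((abs_mul _ _).trans_le (mul_le_mul_of_nonneg_left (abs_haarFnP_le p i x) (abs_nonneg t))))
        (hvC x)))
      (φ := fun y => |y| ^ p) (continuous_abs.rpow_const fun _ => Or.inr hp0.le)
  have hinteg : ∫ x, |f t₀ x| ^ p ∂unitMeasure ≤ ∫ x, |f 0 x| ^ p ∂unitMeasure := by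
    rw [← pnorm_rpow hp (hfm t₀), ← pnorm_rpow hp (hfm 0)]
    exact Real.rpow_le_rpow (pnorm_nonneg p _) (hmin 0) hp0.le
  have hle := setIntegral_add_setIntegral_le_of_integral_le i (hfi t₀) (hfi 0) hinteg
    fun x hx => by simp [f, haarFnP, hx]
  have hpos : ∀ t, ∫ x in {x | haarFn i x = 1}, |f t x| ^ p ∂unitMeasure =
      ∫ x in {x | haarFn i x = 1}, |u x₀ + t / N + v x| ^ p ∂unitMeasure := fun t =>
    setIntegral_congr_fun (measurableSet_haarFn_eq i 1) fun x (hx : haarFn i x = 1) => by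
      simp only [f, haarFnP, huc x (hx.trans_ne one_ne_zero), hx, ← hN, mul_one_div]
  have hneg : ∀ t, ∫ x in {x | haarFn i x = -1}, |f t x| ^ p ∂unitMeasure =
      ∫ x in {x | haarFn i x = -1}, |u x₀ - t / N + v x| ^ p ∂unitMeasure := fun t =>
    setIntegral_congr_fun (measurableSet_haarFn_eq i (-1)) fun x (hx : haarFn i x = -1) => by
      simp only [f, haarFnP, huc x (hx.trans_ne (by norm_num)), hx, ← hN]
      congr 2; ring
  rw [hpos, hpos, hneg, hneg, zero_div, add_zero, sub_zero] at hle
  have hMN : N ^ p = unitMeasure.real {x | haarFn i x = 1} +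
      unitMeasure.real {x | haarFn i x = -1} := pnorm_haarFn_rpow hp i
  have hvp : Integrable (fun x => |v x| ^ p) unitMeasure :=
    hvm.integrable_continuous_comp hvC (φ := fun y => |y| ^ p)
      (continuous_abs.rpow_const fun _ => Or.inr hp0.le)
  have hvS : ∫ x in {x | haarFn i x = 1}, |v x| ^ p ∂unitMeasure +
      ∫ x in {x | haarFn i x = -1}, |v x| ^ p ∂unitMeasure ≤ S ^ p := by
    rw [← setIntegral_union (disjoint_haarFn_eq i) (measurableSet_haarFn_eq i (-1)) hvp.integrableOn
      hvp.integrableOn]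
    refine (setIntegral_le_integral hvp (Filter.Eventually.of_forall fun x =>
      Real.rpow_nonneg (abs_nonneg _) p)).trans ?_
    rw [← pnorm_rpow hp hvm]
    exact Real.rpow_le_rpow (pnorm_nonneg p _) (pnorm_haarSum_le j a _ hp) hp0.le
  set Z := max 4 (2 ^ ((p - 3) / 2) * Real.sqrt (p * (p - 1))) with hZ
  have hZpos : 0 < Z := lt_max_of_lt_left (by norm_num)
  have hbound : ∀ T, S < T → |t₀| ≤ Z * T := by
    intro T hT
    have hT0 : 0 < T := hS0.trans_lt hT
    have h := abs_le_of_setIntegral_le hp hvm hvC (hv0 1) (hv0 (-1)) hc (haarMass_pos i)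
      (div_pos hT0 hNpos) (by
        rw [← hMN, ← Real.mul_rpow hNpos.le (div_pos hT0 hNpos).le, mul_div_cancel₀ _ hNpos.ne']
        exact hvS.trans (Real.rpow_le_rpow hS0 hT.le hp0.le)) hle
    rw [abs_div, abs_of_pos hNpos, ← mul_div_assoc] at h
    exact (div_le_div_iff_of_pos_right hNpos).1 h
  rw [← div_le_iff₀' hZpos]
  exact le_of_forall_gt_imp_ge_of_dense fun T hT => (div_le_iff₀' hZpos).2 (hbound T hT)
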